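/- arXiv:1801.02968 — 6 statements merged into one kernel-verified Lean document; each statement's English description precedes it below -/
import Mathlib

section
/- Let a, b, c be integers with 3 ≤ a ≤ b ≤ c. Then 1/a + 1/b + 1/c > 1/2 (i.e., the pattern (a,b,c) has positive combinatorial curvature) if and only if one of the following holds: (a,b) ∈ {(3,3),(3,4),(3,5),(3,6),(4,4)} with c ≥ b arbitrary; or (a,b) = (3,7) and c ≤ 41; or (a,b) = (3,8) and c ≤ 23; or (a,b) = (3,9) and c ≤ 17; or (a,b) = (3,10) and c ≤ 14; or (a,b) = (3,11) and c ≤ 13; or (a,b) = (4,5) and c ≤ 19; or (a,b) = (4,6) and c ≤ 11; or (a,b) = (4,7) and c ≤ 9; or (a,b) = (5,5) and c ≤ 9; or (a,b) = (5,6) and c ≤ 7. -/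
theorem half_lt_sum_one_div_iff {a b c : ℤ} (ha : 0 < a) (hb : 0 < b) (hc : 0 < c) :
    1 / 2 < 1 / (a : ℚ) + 1 / (b : ℚ) + 1 / (c : ℚ) ↔
      a * b * c < 2 * (a * b + b * c + c * a) := by
  have ha' : (0 : ℚ) < a := by exact_mod_cast ha
  have hb' : (0 : ℚ) < b := by exact_mod_cast hb
  have hc' : (0 : ℚ) < c := by exact_mod_cast hc
  have hsum : 1 / (a : ℚ) + 1 / (b : ℚ) + 1 / (c : ℚ) =
      (a * b + b * c + c * a) / (a * b * c) := by
    field_simp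
    ring
  rw [hsum, div_lt_div_iff₀ two_pos (by positivity), one_mul, mul_comm _ (2 : ℚ)]
  exact_mod_cast Iff.rfl

theorem positive_curvature_degree_three_patterns (a b c : ℤ)
    (ha : 3 ≤ a) (hab : a ≤ b) (hbc : b ≤ c) :
    (1 / (a : ℚ) + 1 / (b : ℚ) + 1 / (c : ℚ) > 1 / 2) ↔
      ((a = 3 ∧ b = 3) ∨ (a = 3 ∧ b = 4) ∨ (a = 3 ∧ b = 5) ∨ (a = 3 ∧ b = 6) ∨
        (a = 4 ∧ b = 4) ∨
        (a = 3 ∧ b = 7 ∧ c ≤ 41) ∨ (a = 3 ∧ b = 8 ∧ c ≤ 23) ∨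
        (a = 3 ∧ b = 9 ∧ c ≤ 17) ∨ (a = 3 ∧ b = 10 ∧ c ≤ 14) ∨
        (a = 3 ∧ b = 11 ∧ c ≤ 13) ∨ (a = 4 ∧ b = 5 ∧ c ≤ 19) ∨
        (a = 4 ∧ b = 6 ∧ c ≤ 11) ∨ (a = 4 ∧ b = 7 ∧ c ≤ 9) ∨
        (a = 5 ∧ b = 5 ∧ c ≤ 9) ∨ (a = 5 ∧ b = 6 ∧ c ≤ 7)) := by
  rw [gt_iff_lt, half_lt_sum_one_div_iff (by lia) (by lia) (by lia)]
  constructor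
  · intro h
    have ha6 : a < 6 := by
      by_contra! ha6
      nlinarith [mul_le_mul_of_nonneg_right ha6 (mul_nonneg (by lia) (by lia) : 0 ≤ b * c),
        mul_le_mul_of_nonneg_right hab (by lia : 0 ≤ c),
        mul_le_mul_of_nonneg_left (hab.trans hbc) (by lia : 0 ≤ b)]
    have hb12 : (a - 2) * b < 4 * a := by
      by_contra! hb12
      nlinarith [mul_le_mul_of_nonneg_right hb12 (by lia : 0 ≤ c),
        mul_le_mul_of_nonneg_left hbc (by lia : 0 ≤ a)]
    have hb : b < 12 := by interval_cases a <;> lia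
    interval_cases a <;> interval_cases b <;> lia
  · rintro (⟨rfl, rfl⟩ | ⟨rfl, rfl⟩ | ⟨rfl, rfl⟩ | ⟨rfl, rfl⟩ | ⟨rfl, rfl⟩ |
      ⟨rfl, rfl, hc⟩ | ⟨rfl, rfl, hc⟩ | ⟨rfl, rfl, hc⟩ | ⟨rfl, rfl, hc⟩ | ⟨rfl, rfl, hc⟩ |
      ⟨rfl, rfl, hc⟩ | ⟨rfl, rfl, hc⟩ | ⟨rfl, rfl, hc⟩ | ⟨rfl, rfl, hc⟩ | ⟨rfl, rfl, hc⟩) <;>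
      lia
end

section
/- Let a, b, c, d be integers with 3 ≤ a ≤ b ≤ c ≤ d. Then 1/a + 1/b + 1/c + 1/d > 1 (i.e., the pattern (a,b,c,d) has positive combinatorial curvature) if and only if one of the following holds: (a,b,c) = (3,3,3) with d ≥ 3 arbitrary; or (a,b,c) = (3,3,4) and 4 ≤ d ≤ 11; or (a,b,c) = (3,3,5) and 5 ≤ d ≤ 7; or (a,b,c) = (3,4,4) and 4 ≤ d ≤ 5. -/
theorem one_div_intCast_le (m n : ℤ) (hm : 0 < m) (hmn : m ≤ n) :
    1 / (n : ℚ) ≤ 1 / (m : ℚ) :=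
  one_div_le_one_div_of_le (by exact_mod_cast hm) (by exact_mod_cast hmn)

theorem positive_curvature_degree_four_patterns (a b c d : ℤ)
    (ha : 3 ≤ a) (hab : a ≤ b) (hbc : b ≤ c) (hcd : c ≤ d) :
    (1 / (a : ℚ) + 1 / (b : ℚ) + 1 / (c : ℚ) + 1 / (d : ℚ) > 1) ↔
      ((a = 3 ∧ b = 3 ∧ c = 3) ∨
        (a = 3 ∧ b = 3 ∧ c = 4 ∧ 4 ≤ d ∧ d ≤ 11) ∨
        (a = 3 ∧ b = 3 ∧ c = 5 ∧ 5 ≤ d ∧ d ≤ 7) ∨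
        (a = 3 ∧ b = 4 ∧ c = 4 ∧ 4 ≤ d ∧ d ≤ 5)) := by
  constructor
  · intro h
    have ha3 : a = 3 := by
      by_contra hne
      have h₁ := one_div_intCast_le 4 a (by omega) (by omega)
      have h₂ := one_div_intCast_le 4 b (by omega) (by omega)
      have h₃ := one_div_intCast_le 4 c (by omega) (by omega)
      have h₄ := one_div_intCast_le 4 d (by omega) (by omega)
      norm_num at h₁ h₂ h₃ h₄ h
      linarith
    subst ha3
    have hb4 : b ≤ 4 := by
      by_contra! hlt
      have h₂ := one_div_intCast_le 5 b (by omega) (by omega)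
      have h₃ := one_div_intCast_le 5 c (by omega) (by omega)
      have h₄ := one_div_intCast_le 5 d (by omega) (by omega)
      norm_num at h₂ h₃ h₄ h
      linarith
    have hc5 : c ≤ 5 := by
      by_contra! hlt
      have h₂ := one_div_intCast_le 3 b (by omega) (by omega)
      have h₃ := one_div_intCast_le 6 c (by omega) (by omega)
      have h₄ := one_div_intCast_le 6 d (by omega) (by omega)
      norm_num at h₂ h₃ h₄ h
      linarith
    have d_lt (n : ℤ) (hn : 0 < n)
        (hs : 1 / (3 : ℚ) + 1 / (b : ℚ) + 1 / (c : ℚ) + 1 / (n : ℚ) ≤ 1) : d < n := by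
      by_contra! hle
      have h₄ := one_div_intCast_le n d hn hle
      push_cast at h
      linarith
    interval_cases b <;> interval_cases c
    · simp
    · have := d_lt 12 (by norm_num) (by norm_num)
      omega
    · have := d_lt 8 (by norm_num) (by norm_num)
      omega
    · have := d_lt 6 (by norm_num) (by norm_num)
      omega
    · have := d_lt 5 (by norm_num) (by norm_num)
      omega
  · rintro (⟨rfl, rfl, rfl⟩ | ⟨rfl, rfl, rfl, -, hd⟩ | ⟨rfl, rfl, rfl, -, hd⟩ |
      ⟨rfl, rfl, rfl, -, hd⟩)
    · have hd : 0 < 1 / (d : ℚ) := one_div_pos.mpr (by exact_mod_cast (by omega : 0 < d))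
      push_cast
      linarith
    all_goals
      have h₄ := one_div_intCast_le d _ (by omega) hd
      norm_num at h₄ ⊢
      linarith
end

section
/- Let a, b, c, d, e be integers with 3 ≤ a ≤ b ≤ c ≤ d ≤ e. Then 1/a + 1/b + 1/c + 1/d + 1/e > 3/2 (i.e., the pattern (a,b,c,d,e) has positive combinatorial curvature) if and only if (a,b,c,d) = (3,3,3,3) and 3 ≤ e ≤ 5. -/
theorem positive_curvature_degree_five_patterns (a b c d e : ℤ)
    (ha : 3 ≤ a) (hab : a ≤ b) (hbc : b ≤ c) (hcd : c ≤ d) (hde : d ≤ e) :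
    (1 / (a : ℚ) + 1 / (b : ℚ) + 1 / (c : ℚ) + 1 / (d : ℚ) + 1 / (e : ℚ) > 3 / 2) ↔
      (a = 3 ∧ b = 3 ∧ c = 3 ∧ d = 3 ∧ 3 ≤ e ∧ e ≤ 5) := by
  have inv_le {m n : ℤ} (hm : 0 < m) (hmn : m ≤ n) : 1 / (n : ℚ) ≤ 1 / (m : ℚ) :=
    one_div_le_one_div_of_le (by exact_mod_cast hm) (by exact_mod_cast hmn)
  constructor
  · intro h
    have hd : d = 3 := by
      by_contra hne
      have h₁ := inv_le (by norm_num) ha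
      have h₂ := inv_le (by norm_num) (ha.trans hab)
      have h₃ := inv_le (by norm_num) ((ha.trans hab).trans hbc)
      have h₄ := inv_le (m := 4) (n := d) (by norm_num) (by lia)
      have h₅ := inv_le (m := 4) (n := e) (by norm_num) (by lia)
      norm_num at h₁ h₂ h₃ h₄ h₅ h
      linarith
    obtain ⟨rfl, rfl, rfl, rfl⟩ : a = 3 ∧ b = 3 ∧ c = 3 ∧ d = 3 := by lia
    refine ⟨rfl, rfl, rfl, rfl, hde, ?_⟩
    by_contra hne
    have h₅ := inv_le (m := 6) (n := e) (by norm_num) (by lia)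
    norm_num at h₅ h
    linarith
  · rintro ⟨rfl, rfl, rfl, rfl, -, he⟩
    have h₅ := inv_le (by lia) he
    norm_num at h₅ ⊢
    linarith
end

section
/- Let s be a finite multiset of integers, each at least 3, with card s ≥ 3, and combinatorial curvature Φ(s) = 1 − (card s)/2 + Σ_{k ∈ s} 1/k. Then Φ(s) = 0 if and only if s is one of the following 17 multisets: {3,7,42}, {3,8,24}, {3,9,18}, {3,10,15}, {3,12,12}, {4,5,20}, {4,6,12}, {4,8,8}, {5,5,10}, {6,6,6}, {3,3,4,12}, {3,3,6,6}, {3,4,4,6}, {4,4,4,4}, {3,3,3,3,6}, {3,3,3,4,4}, {3,3,3,3,3,3}. -/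
/-- Combinatorial curvature of a vertex pattern `s` (multiset of face degrees). -/
def curvature (s : Multiset ℤ) : ℚ :=
  1 - (s.card : ℚ) / 2 + (s.map (fun k => (1 : ℚ) / (k : ℚ))).sum

theorem one_div_intCast_le_s4 {a b : ℤ} (ha : 0 < a) (hab : a ≤ b) : 1 / (b : ℚ) ≤ 1 / (a : ℚ) :=
  one_div_le_one_div_of_le (by exact_mod_cast ha) (by exact_mod_cast hab)

/-- If the reciprocal of `k` exceeds that of `m + 1`, then `k ≤ m`. -/
theorem le_of_one_div_lt {k m : ℤ} (hm : 0 < m + 1) (h : 1 / ((m + 1 : ℤ) : ℚ) < 1 / (k : ℚ)) :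
    k ≤ m := by
  by_contra! hlt
  exact absurd (one_div_intCast_le_s4 hm hlt) (not_le.mpr h)

theorem one_div_intCast_le_third {a : ℤ} (ha : 3 ≤ a) : 1 / (a : ℚ) ≤ 1 / 3 := by
  simpa using one_div_intCast_le_s4 (by norm_num) ha

theorem eq_of_sum_three_reciprocals {a b c : ℤ} (ha : 3 ≤ a)
    (hab : a ≤ b) (hbc : b ≤ c)
    (h : 1 / (a : ℚ) + 1 / (b : ℚ) + 1 / (c : ℚ) = 1 / 2) :
    [a, b, c] = [3, 7, 42] ∨
      [a, b, c] = [3, 8, 24] ∨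
      [a, b, c] = [3, 9, 18] ∨
      [a, b, c] = [3, 10, 15] ∨
      [a, b, c] = [3, 12, 12] ∨
      [a, b, c] = [4, 5, 20] ∨
      [a, b, c] = [4, 6, 12] ∨
      [a, b, c] = [4, 8, 8] ∨
      [a, b, c] = [5, 5, 10] ∨
      [a, b, c] = [6, 6, 6] := by
  have hb : 3 ≤ b := ha.trans hab
  have hc : 3 ≤ c := hb.trans hbc
  have ta := one_div_intCast_le_third ha
  have rab := one_div_intCast_le_s4 (by lia) hab
  have rbc := one_div_intCast_le_s4 (by lia) hbc
  have a_le : a ≤ 6 := le_of_one_div_lt (by norm_num) (by norm_num at *; linarith)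
  have b_le : b ≤ 12 := le_of_one_div_lt (by norm_num) (by norm_num at *; linarith)
  clear ta rab rbc
  have a_ne : (a : ℚ) ≠ 0 := by norm_cast; lia
  have b_ne : (b : ℚ) ≠ 0 := by norm_cast; lia
  have c_ne : (c : ℚ) ≠ 0 := by norm_cast; lia
  field_simp at h
  norm_cast at h
  simp only [List.cons.injEq, and_true]
  interval_cases a <;> interval_cases b <;> lia

theorem eq_of_sum_four_reciprocals {a b c d : ℤ} (ha : 3 ≤ a)
    (hab : a ≤ b) (hbc : b ≤ c) (hcd : c ≤ d)
    (h : 1 / (a : ℚ) + 1 / (b : ℚ) + 1 / (c : ℚ) + 1 / (d : ℚ) = 1) :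
    [a, b, c, d] = [3, 3, 4, 12] ∨
      [a, b, c, d] = [3, 3, 6, 6] ∨
      [a, b, c, d] = [3, 4, 4, 6] ∨
      [a, b, c, d] = [4, 4, 4, 4] := by
  have hb : 3 ≤ b := ha.trans hab
  have hc : 3 ≤ c := hb.trans hbc
  have hd : 3 ≤ d := hc.trans hcd
  have ta := one_div_intCast_le_third ha
  have tb := one_div_intCast_le_third hb
  have rab := one_div_intCast_le_s4 (by lia) hab
  have rbc := one_div_intCast_le_s4 (by lia) hbc
  have rcd := one_div_intCast_le_s4 (by lia) hcd
  have a_le : a ≤ 4 := le_of_one_div_lt (by norm_num) (by norm_num at *; linarith)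
  have b_le : b ≤ 4 := le_of_one_div_lt (by norm_num) (by norm_num at *; linarith)
  have c_le : c ≤ 6 := le_of_one_div_lt (by norm_num) (by norm_num at *; linarith)
  clear ta tb rab rbc rcd
  have a_ne : (a : ℚ) ≠ 0 := by norm_cast; lia
  have b_ne : (b : ℚ) ≠ 0 := by norm_cast; lia
  have c_ne : (c : ℚ) ≠ 0 := by norm_cast; lia
  have d_ne : (d : ℚ) ≠ 0 := by norm_cast; lia
  field_simp at h
  norm_cast at h
  simp only [List.cons.injEq, and_true]
  interval_cases a <;> interval_cases b <;> interval_cases c <;> lia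

theorem eq_of_sum_five_reciprocals {a b c d e : ℤ} (ha : 3 ≤ a)
    (hab : a ≤ b) (hbc : b ≤ c) (hcd : c ≤ d) (hde : d ≤ e)
    (h : 1 / (a : ℚ) + 1 / (b : ℚ) + 1 / (c : ℚ) + 1 / (d : ℚ) + 1 / (e : ℚ) = 3 / 2) :
    [a, b, c, d, e] = [3, 3, 3, 3, 6] ∨
      [a, b, c, d, e] = [3, 3, 3, 4, 4] := by
  have hb : 3 ≤ b := ha.trans hab
  have hc : 3 ≤ c := hb.trans hbc
  have hd : 3 ≤ d := hc.trans hcd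
  have he : 3 ≤ e := hd.trans hde
  have ta := one_div_intCast_le_third ha
  have tb := one_div_intCast_le_third hb
  have tc := one_div_intCast_le_third hc
  have rab := one_div_intCast_le_s4 (by lia) hab
  have rbc := one_div_intCast_le_s4 (by lia) hbc
  have rcd := one_div_intCast_le_s4 (by lia) hcd
  have rde := one_div_intCast_le_s4 (by lia) hde
  have a_le : a ≤ 3 := le_of_one_div_lt (by norm_num) (by norm_num at *; linarith)
  have b_le : b ≤ 3 := le_of_one_div_lt (by norm_num) (by norm_num at *; linarith)
  have c_le : c ≤ 3 := le_of_one_div_lt (by norm_num) (by norm_num at *; linarith)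
  have d_le : d ≤ 4 := le_of_one_div_lt (by norm_num) (by norm_num at *; linarith)
  clear ta tb tc rab rbc rcd rde
  have a_ne : (a : ℚ) ≠ 0 := by norm_cast; lia
  have b_ne : (b : ℚ) ≠ 0 := by norm_cast; lia
  have c_ne : (c : ℚ) ≠ 0 := by norm_cast; lia
  have d_ne : (d : ℚ) ≠ 0 := by norm_cast; lia
  have e_ne : (e : ℚ) ≠ 0 := by norm_cast; lia
  field_simp at h
  norm_cast at h
  simp only [List.cons.injEq, and_true]
  obtain rfl : a = 3 := by lia
  obtain rfl : b = 3 := by lia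
  obtain rfl : c = 3 := by lia
  interval_cases d <;> lia

theorem eq_of_sum_six_reciprocals {a b c d e f : ℤ} (ha : 3 ≤ a)
    (hab : a ≤ b) (hbc : b ≤ c) (hcd : c ≤ d) (hde : d ≤ e) (hef : e ≤ f)
    (h : 1 / (a : ℚ) + 1 / (b : ℚ) + 1 / (c : ℚ) + 1 / (d : ℚ) + 1 / (e : ℚ) + 1 / (f : ℚ) = 2) :
    [a, b, c, d, e, f] = [3, 3, 3, 3, 3, 3] := by
  have hb : 3 ≤ b := ha.trans hab
  have hc : 3 ≤ c := hb.trans hbc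
  have hd : 3 ≤ d := hc.trans hcd
  have he : 3 ≤ e := hd.trans hde
  have hf : 3 ≤ f := he.trans hef
  have ta := one_div_intCast_le_third ha
  have tb := one_div_intCast_le_third hb
  have tc := one_div_intCast_le_third hc
  have td := one_div_intCast_le_third hd
  have rab := one_div_intCast_le_s4 (by lia) hab
  have rbc := one_div_intCast_le_s4 (by lia) hbc
  have rcd := one_div_intCast_le_s4 (by lia) hcd
  have rde := one_div_intCast_le_s4 (by lia) hde
  have ref := one_div_intCast_le_s4 (by lia) hef
  have a_le : a ≤ 3 := le_of_one_div_lt (by norm_num) (by norm_num at *; linarith)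
  have b_le : b ≤ 3 := le_of_one_div_lt (by norm_num) (by norm_num at *; linarith)
  have c_le : c ≤ 3 := le_of_one_div_lt (by norm_num) (by norm_num at *; linarith)
  have d_le : d ≤ 3 := le_of_one_div_lt (by norm_num) (by norm_num at *; linarith)
  have e_le : e ≤ 3 := le_of_one_div_lt (by norm_num) (by norm_num at *; linarith)
  clear ta tb tc td rab rbc rcd rde ref
  have a_ne : (a : ℚ) ≠ 0 := by norm_cast; lia
  have b_ne : (b : ℚ) ≠ 0 := by norm_cast; lia
  have c_ne : (c : ℚ) ≠ 0 := by norm_cast; lia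
  have d_ne : (d : ℚ) ≠ 0 := by norm_cast; lia
  have e_ne : (e : ℚ) ≠ 0 := by norm_cast; lia
  have f_ne : (f : ℚ) ≠ 0 := by norm_cast; lia
  field_simp at h
  norm_cast at h
  simp only [List.cons.injEq, and_true]
  obtain rfl : a = 3 := by lia
  obtain rfl : b = 3 := by lia
  obtain rfl : c = 3 := by lia
  obtain rfl : d = 3 := by lia
  obtain rfl : e = 3 := by lia
  lia

theorem curvature_coe (l : List ℤ) :
    curvature l = 1 - (l.length : ℚ) / 2 + (l.map fun k : ℤ => 1 / (k : ℚ)).sum := by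
  have : (do let a ← (l : Multiset ℤ); pure (a : ℚ)) =
      (l : Multiset ℤ).map fun k : ℤ => (k : ℚ) := by
    simp only [Multiset.bind_def, Multiset.pure_def, Multiset.bind_singleton]
  rw [curvature, this, Multiset.map_map, Multiset.map_coe, Multiset.sum_coe, Multiset.coe_card]
  rfl

theorem length_le_six_of_curvature_nonneg {l : List ℤ} (h3 : ∀ k ∈ l, 3 ≤ k)
    (h : 0 ≤ curvature l) : l.length ≤ 6 := by
  have hsum := List.sum_le_card_nsmul (l.map fun k : ℤ => 1 / (k : ℚ)) (1 / 3) (by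
    simp only [List.mem_map]
    rintro _ ⟨k, hk, rfl⟩
    exact one_div_intCast_le_third (h3 k hk))
  rw [curvature_coe] at h
  rw [List.length_map, nsmul_eq_mul] at hsum
  have : (l.length : ℚ) ≤ 6 := by linarith
  exact_mod_cast this

theorem vanishing_curvature_patterns (s : Multiset ℤ)
    (h3 : ∀ k ∈ s, (3 : ℤ) ≤ k) (hcard : 3 ≤ Multiset.card s) :
    curvature s = 0 ↔
      (s = {3, 7, 42} ∨ s = {3, 8, 24} ∨ s = {3, 9, 18} ∨ s = {3, 10, 15} ∨
        s = {3, 12, 12} ∨ s = {4, 5, 20} ∨ s = {4, 6, 12} ∨ s = {4, 8, 8} ∨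
        s = {5, 5, 10} ∨ s = {6, 6, 6} ∨ s = {3, 3, 4, 12} ∨ s = {3, 3, 6, 6} ∨
        s = {3, 4, 4, 6} ∨ s = {4, 4, 4, 4} ∨ s = {3, 3, 3, 3, 6} ∨
        s = {3, 3, 3, 4, 4} ∨ s = {3, 3, 3, 3, 3, 3}) := by
  constructor
  · intro h
    obtain ⟨l, hl, rfl⟩ : ∃ l : List ℤ, l.Pairwise (· ≤ ·) ∧ (l : Multiset ℤ) = s :=
      ⟨s.sort, s.pairwise_sort _, s.sort_eq _⟩
    simp only [Multiset.mem_coe, Multiset.coe_card] at h3 hcard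
    have hlen := length_le_six_of_curvature_nonneg h3 h.ge
    rw [curvature_coe] at h
    match l with
    | [] | [_] | [_, _] => simp at hcard
    | [a, b, c] =>
      simp only [← List.isChain_iff_pairwise, List.isChain_cons_cons, List.isChain_singleton,
        and_true] at hl
      simp only [List.map_cons, List.map_nil, List.sum_cons, List.sum_nil, List.length_cons,
        List.length_nil] at h
      push_cast at h
      obtain ⟨hab, hbc⟩ := hl
      have hsol := eq_of_sum_three_reciprocals (h3 a (by simp)) hab hbc
        (by linarith)
      rcases hsol with hl | hl | hl | hl | hl | hl | hl | hl | hl | hl <;> rw [hl] <;> decide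
    | [a, b, c, d] =>
      simp only [← List.isChain_iff_pairwise, List.isChain_cons_cons, List.isChain_singleton,
        and_true] at hl
      simp only [List.map_cons, List.map_nil, List.sum_cons, List.sum_nil, List.length_cons,
        List.length_nil] at h
      push_cast at h
      obtain ⟨hab, hbc, hcd⟩ := hl
      have hsol := eq_of_sum_four_reciprocals (h3 a (by simp)) hab hbc hcd
        (by linarith)
      rcases hsol with hl | hl | hl | hl <;> rw [hl] <;> decide
    | [a, b, c, d, e] =>
      simp only [← List.isChain_iff_pairwise, List.isChain_cons_cons, List.isChain_singleton,
        and_true] at hl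
      simp only [List.map_cons, List.map_nil, List.sum_cons, List.sum_nil, List.length_cons,
        List.length_nil] at h
      push_cast at h
      obtain ⟨hab, hbc, hcd, hde⟩ := hl
      have hsol := eq_of_sum_five_reciprocals (h3 a (by simp)) hab hbc hcd hde
        (by linarith)
      rcases hsol with hl | hl <;> rw [hl] <;> decide
    | [a, b, c, d, e, f] =>
      simp only [← List.isChain_iff_pairwise, List.isChain_cons_cons, List.isChain_singleton,
        and_true] at hl
      simp only [List.map_cons, List.map_nil, List.sum_cons, List.sum_nil, List.length_cons,
        List.length_nil] at h
      push_cast at h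
      obtain ⟨hab, hbc, hcd, hde, hef⟩ := hl
      have hsol := eq_of_sum_six_reciprocals (h3 a (by simp)) hab hbc hcd hde hef
        (by linarith)
      rw [hsol]; decide
    | _ :: _ :: _ :: _ :: _ :: _ :: _ :: _ => simp at hlen; lia
  · rintro (rfl | rfl | rfl | rfl | rfl | rfl | rfl | rfl | rfl | rfl | rfl | rfl | rfl | rfl | rfl |
      rfl | rfl) <;> norm_num [curvature]
end

section
/- Let s be a finite multiset of integers, each at least 3 and each strictly less than 132, with card s ≥ 3, and combinatorial curvature Φ(s) = 1 − (card s)/2 + Σ_{k ∈ s} 1/k. If 0 < Φ(s) < 1/132 (i.e., s is the pattern of a 'bad' vertex), then s is one of the following: {3,7,k} with 32 ≤ k ≤ 41; {3,8,k} with 21 ≤ k ≤ 23; {3,9,k} with 16 ≤ k ≤ 17; {3,10,14}; {3,11,13}; {4,5,k} with 18 ≤ k ≤ 19; or {4,7,9}. -/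
theorem one_div_intCast_le_one_div {m n : ℤ} (hm : 0 < m) (h : m ≤ n) :
    (1 : ℚ) / n ≤ 1 / m :=
  one_div_le_one_div_of_le (by exact_mod_cast hm) (by exact_mod_cast h)

theorem curvature_eq (s : Multiset ℤ) :
    curvature s = 1 - (s.card : ℚ) / 2 + (s.map fun k : ℤ => (1 : ℚ) / k).sum := by
  simp [curvature]

theorem curvature_le_of_forall_three_le {s : Multiset ℤ} (h : ∀ k ∈ s, (3 : ℤ) ≤ k) :
    curvature s ≤ 1 - (s.card : ℚ) / 6 := by
  have hsum := Multiset.sum_le_card_nsmul (s.map fun k : ℤ => (1 : ℚ) / k) (1 / 3) (by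
    intro x hx
    obtain ⟨k, hk, rfl⟩ := Multiset.mem_map.1 hx
    simpa using one_div_intCast_le_one_div (by norm_num) (h k hk))
  rw [Multiset.card_map, nsmul_eq_mul] at hsum
  rw [curvature_eq]
  linarith

theorem bad_triple_cases {a b c : ℤ} (ha : 3 ≤ a) (hab : a ≤ b) (hbc : b ≤ c) (hc : c < 132)
    (hpos : 0 < curvature {a, b, c}) (hlt : curvature {a, b, c} < 1 / 132) :
    (a = 3 ∧ b = 7 ∧ 32 ≤ c ∧ c ≤ 41) ∨ (a = 3 ∧ b = 8 ∧ 21 ≤ c ∧ c ≤ 23) ∨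
      (a = 3 ∧ b = 9 ∧ 16 ≤ c ∧ c ≤ 17) ∨ (a = 3 ∧ b = 10 ∧ c = 14) ∨
      (a = 3 ∧ b = 11 ∧ c = 13) ∨ (a = 4 ∧ b = 5 ∧ 18 ≤ c ∧ c ≤ 19) ∨
      (a = 4 ∧ b = 7 ∧ c = 9) := by
  have ha0 : (0 : ℚ) < a := by exact_mod_cast (by omega : 0 < a)
  have hb0 : (0 : ℚ) < b := by exact_mod_cast (by omega : 0 < b)
  have hc0 : (0 : ℚ) < c := by exact_mod_cast (by omega : 0 < c)
  have hcurv : curvature {a, b, c} = -1 / 2 + (1 / a + (1 / b + 1 / c)) := by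
    simp [curvature_eq]
    ring
  have hclear : curvature {a, b, c} =
      (2 * (a * b + b * c + c * a) - a * b * c) / (2 * (a * b * c)) := by
    rw [hcurv]
    field_simp
    ring
  have hpos' : 0 < 2 * (a * b + b * c + c * a) - a * b * c := by
    rw [hclear, div_pos_iff_of_pos_right (by positivity)] at hpos
    exact_mod_cast hpos
  have hlt' : (2 * (a * b + b * c + c * a) - a * b * c) * 132 < 2 * (a * b * c) := by
    rw [hclear, div_lt_div_iff₀ (by positivity) (by norm_num), one_mul] at hlt
    exact_mod_cast hlt
  rw [hcurv] at hpos
  have hcb := one_div_intCast_le_one_div (by omega) hbc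
  have hba := one_div_intCast_le_one_div (by omega) hab
  have ha5 : a ≤ 5 := by
    by_contra! h
    have := one_div_intCast_le_one_div (m := 6) (by norm_num) h
    push_cast at this
    linarith
  have hb11 : b ≤ 11 := by
    by_contra! h
    have hb := one_div_intCast_le_one_div (m := 12) (by norm_num) h
    have ha := one_div_intCast_le_one_div (m := 3) (by norm_num) ha
    push_cast at hb ha
    linarith
  clear hcurv hclear hcb hba hpos hlt ha0 hb0 hc0
  interval_cases a <;> interval_cases b <;> omega

theorem not_bad_quadruple {a b c d : ℤ} (ha : 3 ≤ a) (hab : a ≤ b) (hbc : b ≤ c) (hcd : c ≤ d)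
    (hd : d < 132) (hpos : 0 < curvature {a, b, c, d}) :
    1 / 132 ≤ curvature {a, b, c, d} := by
  have hcurv : curvature {a, b, c, d} = -1 + (1 / a + (1 / b + (1 / c + 1 / d))) := by
    simp [curvature_eq]
    ring
  rw [hcurv] at hpos ⊢
  have hdc := one_div_intCast_le_one_div (by omega) hcd
  have hcb := one_div_intCast_le_one_div (by omega) hbc
  have hba := one_div_intCast_le_one_div (by omega) hab
  have ha' := one_div_intCast_le_one_div (m := 3) (by norm_num) ha
  have hb' := one_div_intCast_le_one_div (m := 3) (by norm_num) (ha.trans hab)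
  push_cast at ha' hb'
  have ha3 : a ≤ 3 := by
    by_contra! h
    have := one_div_intCast_le_one_div (m := 4) (by norm_num) h
    push_cast at this
    linarith
  have hb4 : b ≤ 4 := by
    by_contra! h
    have := one_div_intCast_le_one_div (m := 5) (by norm_num) h
    push_cast at this
    linarith
  have hc5 : c ≤ 5 := by
    by_contra! h
    have := one_div_intCast_le_one_div (m := 6) (by norm_num) h
    push_cast at this
    linarith
  have hupper (n : ℤ) (hn : 0 < n) (h : (1 : ℚ) / n < 1 / d) : d < n := by
    exact_mod_cast lt_of_one_div_lt_one_div (by exact_mod_cast hn) h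
  have hlower (n : ℤ) (h : d ≤ n) : (1 : ℚ) / n ≤ 1 / d :=
    one_div_intCast_le_one_div (by omega) h
  obtain rfl : a = 3 := le_antisymm ha3 ha
  interval_cases b <;> interval_cases c <;> push_cast at hpos ⊢
  · have := hlower 131 (by omega)
    push_cast at this
    linarith
  · have := hlower 11 (by have := hupper 12 (by norm_num) (by push_cast; linarith); omega)
    push_cast at this
    linarith
  · have := hlower 7 (by have := hupper 8 (by norm_num) (by push_cast; linarith); omega)
    push_cast at this
    linarith
  · have := hlower 5 (by have := hupper 6 (by norm_num) (by push_cast; linarith); omega)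
    push_cast at this
    linarith
  · have := hlower 4 (by have := hupper 5 (by norm_num) (by push_cast; linarith); omega)
    push_cast at this
    linarith

theorem not_bad_quintuple {a b c d e : ℤ} (ha : 3 ≤ a) (hab : a ≤ b) (hbc : b ≤ c) (hcd : c ≤ d)
    (hde : d ≤ e) (hpos : 0 < curvature {a, b, c, d, e}) :
    1 / 132 ≤ curvature {a, b, c, d, e} := by
  have hcurv : curvature {a, b, c, d, e} =
      -3 / 2 + (1 / a + (1 / b + (1 / c + (1 / d + 1 / e)))) := by
    simp [curvature_eq]
    ring
  rw [hcurv] at hpos ⊢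
  have ha' := one_div_intCast_le_one_div (m := 3) (by norm_num) ha
  have hb' := one_div_intCast_le_one_div (m := 3) (n := b) (by norm_num) (by omega)
  have hc' := one_div_intCast_le_one_div (m := 3) (n := c) (by norm_num) (by omega)
  have hd' := one_div_intCast_le_one_div (m := 3) (n := d) (by norm_num) (by omega)
  have hed := one_div_intCast_le_one_div (by omega) hde
  push_cast at ha' hb' hc' hd'
  have hd3 : d ≤ 3 := by
    by_contra! h
    have := one_div_intCast_le_one_div (m := 4) (by norm_num) h
    push_cast at this
    linarith
  have he5 : e ≤ 5 := by
    by_contra! h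
    have := one_div_intCast_le_one_div (m := 6) (by norm_num) h
    push_cast at this
    linarith
  obtain ⟨rfl, rfl, rfl, rfl⟩ : a = 3 ∧ b = 3 ∧ c = 3 ∧ d = 3 := by omega
  have := one_div_intCast_le_one_div (by omega) he5
  push_cast at this ⊢
  linarith

theorem bad_vertex_patterns (s : Multiset ℤ)
    (h3 : ∀ k ∈ s, (3 : ℤ) ≤ k ∧ k < 132) (hcard : 3 ≤ Multiset.card s)
    (hpos : 0 < curvature s) (hlt : curvature s < 1 / 132) :
    (∃ k : ℤ, 32 ≤ k ∧ k ≤ 41 ∧ s = {3, 7, k}) ∨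
      (∃ k : ℤ, 21 ≤ k ∧ k ≤ 23 ∧ s = {3, 8, k}) ∨
      (∃ k : ℤ, 16 ≤ k ∧ k ≤ 17 ∧ s = {3, 9, k}) ∨
      s = {3, 10, 14} ∨ s = {3, 11, 13} ∨
      (∃ k : ℤ, 18 ≤ k ∧ k ≤ 19 ∧ s = {4, 5, k}) ∨
      s = {4, 7, 9} := by
  have hcard5 : s.card ≤ 5 := by
    have h := hpos.trans_le (curvature_le_of_forall_three_le fun k hk => (h3 k hk).1)
    have h6 : (s.card : ℚ) < 6 := by linarith
    have : s.card < 6 := by exact_mod_cast h6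
    omega
  obtain ⟨l, hl, rfl⟩ : ∃ l : List ℤ, l.Pairwise (· ≤ ·) ∧ (l : Multiset ℤ) = s :=
    ⟨s.sort, s.pairwise_sort _, s.sort_eq _⟩
  match l, hl, h3, hcard, hpos, hlt, hcard5 with
  | [a, b, c], hl, h3, _, hpos, hlt, _ =>
    simp only [Multiset.mem_coe, List.mem_cons, List.not_mem_nil, or_false, forall_eq_or_imp,
      forall_eq, List.pairwise_cons] at h3 hl
    obtain ⟨rfl, rfl, hc⟩ | ⟨rfl, rfl, hc⟩ | ⟨rfl, rfl, hc⟩ | ⟨rfl, rfl, rfl⟩ | ⟨rfl, rfl, rfl⟩ |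
        ⟨rfl, rfl, hc⟩ | ⟨rfl, rfl, rfl⟩ :=
      bad_triple_cases h3.1.1 hl.1.1 hl.2.1 h3.2.2.2 hpos hlt
    · exact .inl ⟨c, hc.1, hc.2, rfl⟩
    · exact .inr (.inl ⟨c, hc.1, hc.2, rfl⟩)
    · exact .inr (.inr (.inl ⟨c, hc.1, hc.2, rfl⟩))
    · exact .inr (.inr (.inr (.inl rfl)))
    · exact .inr (.inr (.inr (.inr (.inl rfl))))
    · exact .inr (.inr (.inr (.inr (.inr (.inl ⟨c, hc.1, hc.2, rfl⟩)))))
    · exact .inr (.inr (.inr (.inr (.inr (.inr rfl)))))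
  | [a, b, c, d], hl, h3, _, hpos, hlt, _ =>
    simp only [Multiset.mem_coe, List.mem_cons, List.not_mem_nil, or_false, forall_eq_or_imp,
      forall_eq, List.pairwise_cons] at h3 hl
    exact absurd hlt (not_lt.2
      (not_bad_quadruple h3.1.1 hl.1.1 hl.2.1.1 hl.2.2.1 h3.2.2.2.2 hpos))
  | [a, b, c, d, e], hl, h3, _, hpos, hlt, _ =>
    simp only [Multiset.mem_coe, List.mem_cons, List.not_mem_nil, or_false, forall_eq_or_imp,
      forall_eq, List.pairwise_cons] at h3 hl
    exact absurd hlt (not_lt.2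
      (not_bad_quintuple h3.1.1 hl.1.1 hl.2.1.1 hl.2.2.1.1 hl.2.2.2.1 hpos))
  | [], _, _, hcard, _, _, _ => simp at hcard
  | [_], _, _, hcard, _, _, _ => simp at hcard
  | [_, _], _, _, hcard, _, _, _ => simp at hcard
  | _ :: _ :: _ :: _ :: _ :: _ :: _, _, _, _, _, _, hcard5 =>
    simp only [Multiset.coe_card, List.length_cons] at hcard5
    omega
end

section
/- Let s be a finite multiset of integers, each satisfying 3 ≤ k ≤ 42, with card s ≥ 3, and combinatorial curvature Φ(s) = 1 − (card s)/2 + Σ_{k ∈ s} 1/k. If Φ(s) > 0, then Φ(s) ≥ 1/1722. -/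
theorem curvature_eq_sum_map_one_div (s : Multiset ℤ) :
    curvature s = 1 - (s.card : ℚ) / 2 + (s.map (fun k : ℤ => (1 : ℚ) / (k : ℚ))).sum := by
  simp [curvature, Multiset.bind_singleton]

theorem one_div_intCast_le_one_div_intCast {a b : ℤ} (ha : 0 < a) (hab : a ≤ b) :
    (1 : ℚ) / b ≤ 1 / a :=
  one_div_le_one_div_of_le (by exact_mod_cast ha) (by exact_mod_cast hab)

theorem lt_of_lt_one_div_intCast {a n : ℤ} (hn : 0 < n) (h : (1 : ℚ) / n < 1 / a) : a < n := by
  by_contra! hna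
  exact absurd (one_div_intCast_le_one_div_intCast hn hna) (not_le.mpr h)

theorem one_div_le_of_triple {a b c : ℤ} (ha : 3 ≤ a) (hab : a ≤ b) (hbc : b ≤ c)
    (hc : c ≤ 42) (hpos : 0 < (1 : ℚ) / a + 1 / b + 1 / c - 1 / 2) :
    1 / 1722 ≤ (1 : ℚ) / a + 1 / b + 1 / c - 1 / 2 := by
  have hba := one_div_intCast_le_one_div_intCast (by lia) hab
  have hcb := one_div_intCast_le_one_div_intCast (by lia) hbc
  have ha6 : a < 6 := lt_of_lt_one_div_intCast (by simp) (by push_cast; linarith)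
  have hb12 : b < 12 := by
    have := one_div_intCast_le_one_div_intCast (by simp) ha
    exact lt_of_lt_one_div_intCast (by simp) (by push_cast at *; linarith)
  clear hba hcb
  have key : (1 : ℚ) / a + 1 / b + 1 / c - 1 / 2 =
      ((2 * (b * c + a * c + a * b) - a * b * c : ℤ) : ℚ) / ((2 * a * b * c : ℤ) : ℚ) := by
    have ha0 : (a : ℚ) ≠ 0 := by exact_mod_cast (by lia : a ≠ 0)
    have hb0 : (b : ℚ) ≠ 0 := by exact_mod_cast (by lia : b ≠ 0)
    have hc0 : (c : ℚ) ≠ 0 := by exact_mod_cast (by lia : c ≠ 0)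
    push_cast
    field_simp
  have hden : 0 < 2 * a * b * c := by
    have : 0 < a := by lia
    have : 0 < b := by lia
    have : 0 < c := by lia
    positivity
  have hden' : (0 : ℚ) < ((2 * a * b * c : ℤ) : ℚ) := by exact_mod_cast hden
  rw [key, div_pos_iff_of_pos_right hden'] at hpos
  rw [key, div_le_div_iff₀ (by norm_num) hden']
  norm_cast at hpos ⊢
  clear key hden hden'
  interval_cases a <;> interval_cases b <;> lia

theorem one_div_le_of_quadruple {a b c d : ℤ} (ha : 3 ≤ a) (hab : a ≤ b) (hbc : b ≤ c)
    (hcd : c ≤ d) (hd : d ≤ 42) (hpos : 0 < (1 : ℚ) / a + 1 / b + 1 / c + 1 / d - 1) :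
    1 / 1722 ≤ (1 : ℚ) / a + 1 / b + 1 / c + 1 / d - 1 := by
  have hba := one_div_intCast_le_one_div_intCast (by lia) hab
  have hcb := one_div_intCast_le_one_div_intCast (by lia) hbc
  have hdc := one_div_intCast_le_one_div_intCast (by lia) hcd
  have ha4 : a < 4 := lt_of_lt_one_div_intCast (by simp) (by push_cast; linarith)
  obtain rfl : a = 3 := by lia
  have hb5 : b < 5 := lt_of_lt_one_div_intCast (by simp) (by push_cast at *; linarith)
  have hb3 := one_div_intCast_le_one_div_intCast (by simp) hab
  have hc6 : c < 6 := lt_of_lt_one_div_intCast (by simp) (by push_cast at *; linarith)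
  clear hba hcb hdc hb3
  have key : (1 : ℚ) / (3 : ℤ) + 1 / b + 1 / c + 1 / d - 1 =
      ((3 * (c * d + b * d + b * c) - 2 * b * c * d : ℤ) : ℚ) / ((3 * b * c * d : ℤ) : ℚ) := by
    have hb0 : (b : ℚ) ≠ 0 := by exact_mod_cast (by lia : b ≠ 0)
    have hc0 : (c : ℚ) ≠ 0 := by exact_mod_cast (by lia : c ≠ 0)
    have hd0 : (d : ℚ) ≠ 0 := by exact_mod_cast (by lia : d ≠ 0)
    push_cast
    field_simp
    ring
  have hden : 0 < 3 * b * c * d := by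
    have : 0 < b := by lia
    have : 0 < c := by lia
    have : 0 < d := by lia
    positivity
  have hden' : (0 : ℚ) < ((3 * b * c * d : ℤ) : ℚ) := by exact_mod_cast hden
  rw [key, div_pos_iff_of_pos_right hden'] at hpos
  rw [key, div_le_div_iff₀ (by norm_num) hden']
  norm_cast at hpos ⊢
  clear key hden hden'
  interval_cases b <;> interval_cases c <;> lia

theorem one_div_le_of_quintuple {a b c d e : ℤ} (ha : 3 ≤ a) (hab : a ≤ b) (hbc : b ≤ c)
    (hcd : c ≤ d) (hde : d ≤ e)
    (hpos : 0 < (1 : ℚ) / a + 1 / b + 1 / c + 1 / d + 1 / e - 3 / 2) :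
    1 / 1722 ≤ (1 : ℚ) / a + 1 / b + 1 / c + 1 / d + 1 / e - 3 / 2 := by
  have hba := one_div_intCast_le_one_div_intCast (by lia) hab
  have hcb := one_div_intCast_le_one_div_intCast (by lia) hbc
  have hdc := one_div_intCast_le_one_div_intCast (by lia) hcd
  have hed := one_div_intCast_le_one_div_intCast (by lia) hde
  have ha4 : a < 4 := lt_of_lt_one_div_intCast (by simp) (by push_cast; linarith)
  obtain rfl : a = 3 := by lia
  have hb4 : b < 4 := lt_of_lt_one_div_intCast (by simp) (by push_cast at *; linarith)
  obtain rfl : b = 3 := by lia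
  have hc4 : c < 4 := lt_of_lt_one_div_intCast (by simp) (by push_cast at *; linarith)
  obtain rfl : c = 3 := by lia
  have hd4 : d < 4 := lt_of_lt_one_div_intCast (by simp) (by push_cast at *; linarith)
  obtain rfl : d = 3 := by lia
  have he6 : e < 6 := lt_of_lt_one_div_intCast (by simp) (by push_cast at *; linarith)
  interval_cases e <;> norm_num

theorem curvature_nonpos_of_six_le_card {s : Multiset ℤ} (h3 : ∀ k ∈ s, 3 ≤ k)
    (hcard : 6 ≤ s.card) : curvature s ≤ 0 := by
  have hsum : (s.map (fun k : ℤ => (1 : ℚ) / (k : ℚ))).sum ≤ s.card • (1 / 3 : ℚ) := by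
    rw [← Multiset.card_map (fun k : ℤ => (1 : ℚ) / (k : ℚ)) s]
    refine Multiset.sum_le_card_nsmul _ _ fun x hx => ?_
    obtain ⟨k, hk, rfl⟩ := Multiset.mem_map.mp hx
    simpa using one_div_intCast_le_one_div_intCast (by simp) (h3 k hk)
  have h6 : (6 : ℚ) ≤ s.card := by exact_mod_cast hcard
  rw [nsmul_eq_mul] at hsum
  rw [curvature_eq_sum_map_one_div]
  linarith

theorem curvature_lower_bound (s : Multiset ℤ)
    (h3 : ∀ k ∈ s, (3 : ℤ) ≤ k ∧ k ≤ 42) (hcard : 3 ≤ Multiset.card s)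
    (hpos : 0 < curvature s) :
    1 / 1722 ≤ curvature s := by
  have hcard' : s.card < 6 := by
    by_contra! h
    exact absurd (curvature_nonpos_of_six_le_card (fun k hk => (h3 k hk).1) h) (not_le.mpr hpos)
  obtain ⟨l, hl, rfl⟩ : ∃ l : List ℤ, l.Pairwise (· ≤ ·) ∧ (l : Multiset ℤ) = s :=
    ⟨s.sort (· ≤ ·), s.pairwise_sort _, s.sort_eq _⟩
  rw [curvature_eq_sum_map_one_div] at hpos ⊢
  match l with
  | [] | [_] | [_, _] => simp at hcard
  | [a, b, c] =>
    simp at hl h3 hpos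
    have := @one_div_le_of_triple a b c (by lia) (by lia) (by lia) (by lia)
      (by simp; linarith)
    simp at this ⊢
    linarith
  | [a, b, c, d] =>
    simp at hl h3 hpos
    have := @one_div_le_of_quadruple a b c d (by lia) (by lia) (by lia) (by lia) (by lia)
      (by simp; linarith)
    simp at this ⊢
    linarith
  | [a, b, c, d, e] =>
    simp at hl h3 hpos
    have := @one_div_le_of_quintuple a b c d e (by lia) (by lia) (by lia) (by lia) (by lia)
      (by simp; linarith)
    simp at this ⊢
    linarith
  | _ :: _ :: _ :: _ :: _ :: _ :: _ => simp at hcard'; lia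
end
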